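/- Let $m \ge 2$ and $r \ge 1$ be integers and let $\{a_n\}_{n\ge 1}$ be a decreasing sequence of nonnegative real numbers such that the series $\sum_{n=1}^{\infty} n^{4r+m-1}\, a_{n^m}^2$ converges. Then the series $\sum_{n=1}^{\infty} n^{4r/m}\, a_n^2$ converges. -/

import Mathlib

theorem aux_count (n p : ℕ) : (n+1)^(p+1) ≤ n^(p+1) + (p+1)*(n+1)^p := by
  induction p with
  | zero => simp
  | succ p ih =>
    have h1 := Nat.mul_le_mul_left n ih
    have e : (n+1)^(p+1+1) = n * (n+1)^(p+1) + (n+1)^(p+1) := by ring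
    have e2 : n * (n^(p+1) + (p+1)*(n+1)^p) + (p+1)*(n+1)^p = n^(p+1+1) + (p+1)*(n+1)^(p+1) := by ring
    have e3 : (p+1+1)*(n+1)^(p+1) = (p+1)*(n+1)^(p+1) + (n+1)^(p+1) := by ring
    rw [e, e3]
    have : 0 ≤ (p+1)*(n+1)^p := Nat.zero_le _
    linarith

/-- If `m ≥ 2`, `r ≥ 1` and `{a n}` is a decreasing sequence of nonnegative
reals with `∑ n^(4r+m-1) * (a (n^m))^2 < ∞`, then `∑ n^(4r/m) * (a n)^2` converges. -/
theorem stmt_10 (m r : ℕ) (hm : 2 ≤ m) (hr : 1 ≤ r)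
    (a : ℕ → ℝ)
    (hnonneg : ∀ n, 1 ≤ n → 0 ≤ a n)
    (hdec : ∀ n, 1 ≤ n → a (n + 1) ≤ a n)
    (hsum : Summable (fun n : ℕ => (n : ℝ) ^ (4 * r + m - 1) * (a (n ^ m)) ^ 2)) :
    Summable (fun n : ℕ => (n : ℝ) ^ ((4 * r : ℝ) / m) * (a n) ^ 2) := by
  have hm0 : m ≠ 0 := by omega
  have hmR : (0:ℝ) < m := by positivity
  have hanti : ∀ i j, 1 ≤ i → i ≤ j → a j ≤ a i := by
    intro i j hi hij
    induction j, hij using Nat.le_induction with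
    | base => exact le_rfl
    | succ k hk ih => exact (hdec k (by omega)).trans ih
  have hrR : (0:ℝ) < r := by exact_mod_cast hr
  have hgn : ∀ n : ℕ, 0 ≤ (n : ℝ) ^ ((4 * r : ℝ) / m) * (a n) ^ 2 := fun n => by positivity
  have hfn : ∀ n : ℕ, 0 ≤ (n : ℝ) ^ (4 * r + m - 1) * (a (n ^ m)) ^ 2 := fun n => by positivity
  obtain ⟨p, rfl⟩ : ∃ p, m = p + 1 := ⟨m - 1, by omega⟩
  have hexp : 4 * r + (p + 1) - 1 = 4 * r + p := by omega
  rw [hexp] at hsum hfn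
  set C : ℝ := ((p : ℝ) + 1) * 2 ^ (4 * r + p) with hC
  have hC0 : 0 ≤ C := by positivity
  have block : ∀ n : ℕ, ∑ k ∈ Finset.Ico (n ^ (p+1)) ((n+1) ^ (p+1)),
      (k : ℝ) ^ ((4 * r : ℝ) / (p+1 : ℕ)) * (a k) ^ 2
      ≤ C * ((n : ℝ) ^ (4 * r + p) * (a (n ^ (p+1))) ^ 2) := by
    intro n
    rcases Nat.eq_zero_or_pos n with rfl | hn
    · have : ((4 * r : ℝ) / (p+1 : ℕ)) ≠ 0 := by positivity
      simp only [ne_eq, Nat.add_eq_zero_iff, one_ne_zero, and_false, not_false_eq_true, zero_pow,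
        zero_add, one_pow, Nat.Ico_zero_eq_range, Finset.sum_range_one, Nat.cast_zero]
      rw [Real.zero_rpow this]
      simp only [zero_mul]
      positivity
    · have hn1 : 1 ≤ n ^ (p+1) := Nat.one_le_pow _ _ hn
      have hn2 : ((n:ℝ)+1) ≤ 2 * n := by
        have : (1:ℝ) ≤ n := by exact_mod_cast hn
        linarith
      have hterm : ∀ k ∈ Finset.Ico (n ^ (p+1)) ((n+1) ^ (p+1)),
          (k : ℝ) ^ ((4 * r : ℝ) / (p+1 : ℕ)) * (a k) ^ 2
            ≤ (2 * n : ℝ) ^ (4 * r) * (a (n ^ (p+1))) ^ 2 := by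
        intro k hk
        rw [Finset.mem_Ico] at hk
        have h1 : a k ≤ a (n ^ (p+1)) := hanti _ _ hn1 hk.1
        have h0 : 0 ≤ a k := hnonneg k (hn1.trans hk.1)
        have hk2 : (k : ℝ) ≤ (2 * n : ℝ) ^ (p+1) := by
          calc (k : ℝ) ≤ ((n:ℝ)+1) ^ (p+1) := by exact_mod_cast hk.2.le
            _ ≤ _ := by gcongr
        have h3 : (k : ℝ) ^ ((4 * r : ℝ) / (p+1 : ℕ)) ≤ (2 * n : ℝ) ^ (4 * r) := by
          calc (k : ℝ) ^ ((4 * r : ℝ) / (p+1 : ℕ))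
              ≤ ((2 * n : ℝ) ^ (p+1)) ^ ((4 * r : ℝ) / (p+1 : ℕ)) := by gcongr
            _ = (2 * n : ℝ) ^ (4 * r) := by
              rw [← Real.rpow_natCast, ← Real.rpow_mul (by positivity), mul_div_cancel₀ _ hmR.ne',
                ← Real.rpow_natCast]
              push_cast
              rfl
        gcongr
      have hs := Finset.sum_le_card_nsmul _ _ _ hterm
      rw [Nat.card_Ico, nsmul_eq_mul] at hs
      have hcard : (((n+1) ^ (p+1) - n ^ (p+1) : ℕ) : ℝ) ≤ ((p:ℝ)+1) * (2 * n) ^ p := by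
        have h := aux_count n p
        have h' : (n+1) ^ (p+1) - n ^ (p+1) ≤ (p+1)*(n+1)^p := by omega
        calc (((n+1) ^ (p+1) - n ^ (p+1) : ℕ) : ℝ) ≤ ((p:ℝ)+1) * ((n:ℝ)+1) ^ p := by
              exact_mod_cast h'
          _ ≤ _ := by gcongr
      refine hs.trans ?_
      calc _ ≤ (((p:ℝ)+1) * (2 * n) ^ p) * ((2 * n : ℝ) ^ (4 * r) * (a (n ^ (p+1))) ^ 2) := by
            gcongr
        _ = _ := by rw [hC]; ring
  have hpart : ∀ N : ℕ, ∑ k ∈ Finset.range (N ^ (p+1)),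
      (k : ℝ) ^ ((4 * r : ℝ) / (p+1 : ℕ)) * (a k) ^ 2
      ≤ C * ∑ n ∈ Finset.range N, ((n : ℝ) ^ (4 * r + p) * (a (n ^ (p+1))) ^ 2) := by
    intro N
    induction N with
    | zero => simp
    | succ N ih =>
      rw [Finset.sum_range_succ, mul_add, ← Finset.sum_range_add_sum_Ico _
        (Nat.pow_le_pow_left (Nat.le_succ N) (p+1))]
      exact add_le_add ih (block N)
  refine summable_of_sum_range_le (c := C * ∑' n : ℕ, ((n : ℝ) ^ (4 * r + p) * (a (n ^ (p+1))) ^ 2))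
    hgn ?_
  intro N
  refine (Finset.sum_le_sum_of_subset_of_nonneg (Finset.range_mono (Nat.le_self_pow hm0 N))
    (fun i _ _ => hgn i)).trans ((hpart N).trans ?_)
  exact mul_le_mul_of_nonneg_left (hsum.sum_le_tsum _ (fun i _ => hfn i)) hC0
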